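/- Let ω be a free ultrafilter on ℕ, let (n_k) be a sequence of positive integers with n_k → ∞, and let u_k ∈ M_{n_k}(ℂ) be unitary matrices. Suppose τ : ℕ* → ℂ is such that for every m ∈ ℕ*, Tr(u_k^m) converges to τ(m) along ω, and for each i ∈ ℕ* define c_i = ∑_{S ⊆ primeFactors(i)} (−1)^{|S|} τ(i / ∏_{p ∈ S} p). Then there exist permutation matrices p_k ∈ P_{n_k} and unitary matrices w_k ∈ M_{n_k}(ℂ) such that ‖w_k u_k w_k* − p_k‖₂ converges to 0 along ω, if and only if for every i ∈ ℕ* the number c_i is a nonnegative real. -/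

import Mathlib

open Filter

/-- The normalized trace `Tr(A) = (1/n) ∑ᵢ aᵢᵢ`. -/
noncomputable def nTr {n : ℕ} (A : Matrix (Fin n) (Fin n) ℂ) : ℂ :=
  Matrix.trace A / n

/-- The normalized trace norm `‖A‖₂ = √((1/n) ∑_{i,j} |a_{ij}|²)`. -/
noncomputable def trNorm {n : ℕ} (A : Matrix (Fin n) (Fin n) ℂ) : ℝ :=
  Real.sqrt ((∑ i, ∑ j, Complex.normSq (A i j)) / n)

/-- `A` is a permutation matrix: `A i j = 1` if `i = σ j` and `0` otherwise, for some
permutation `σ`. -/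
def IsPermMatrix {n : ℕ} (A : Matrix (Fin n) (Fin n) ℂ) : Prop :=
  ∃ σ : Equiv.Perm (Fin n), ∀ i j, A i j = if i = σ j then 1 else 0

open Module.End in
/-- The eigenspaces of an isometry of a finite-dimensional complex space span. -/
theorem orthogonal_iSup_eigenspace_eq_bot_of_isometry {E : Type*} [NormedAddCommGroup E]
    [InnerProductSpace ℂ E] [FiniteDimensional ℂ E] (T : E →ₗ[ℂ] E)
    (hT : ∀ x y, inner ℂ (T x) (T y) = inner ℂ x y) :
    (⨆ z : ℂ, eigenspace T z)ᗮ = ⊥ := by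
  have hinv : ∀ x ∈ (⨆ z : ℂ, eigenspace T z)ᗮ, T x ∈ (⨆ z : ℂ, eigenspace T z)ᗮ := by
    intro x hx
    rw [← Submodule.iInf_orthogonal, Submodule.mem_iInf] at hx ⊢
    intro z v hv
    have h := hT v x
    rw [mem_eigenspace_iff.mp hv, hx z v hv, inner_smul_left] at h
    rcases mul_eq_zero.mp h with h | h
    · have hz : z = 0 := by simpa using h
      have h0 : inner ℂ v v = 0 := by
        rw [← hT, mem_eigenspace_iff.mp hv, hz]; simp
      rw [inner_self_eq_zero.mp h0]; simp
    · exact h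
  rw [← Submodule.subsingleton_iff_eq_bot]
  by_contra hns
  rw [not_subsingleton_iff_nontrivial] at hns
  obtain ⟨z, hz⟩ := Module.End.exists_eigenvalue (T.restrict hinv)
  obtain ⟨v, hv⟩ := hz.exists_hasEigenvector
  have hv1 : (v : E) ∈ eigenspace T z := by
    rw [mem_eigenspace_iff]
    have := congrArg Subtype.val hv.apply_eq_smul
    simpa using this
  have h0 : inner ℂ (v : E) (v : E) = 0 :=
    v.2 _ (Submodule.mem_iSup_of_mem z hv1)
  exact hv.2 (Subtype.ext (inner_self_eq_zero.mp h0))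

open Module.End in
theorem exists_orthonormalBasis_eigenvectors_of_isometry {E : Type*} [NormedAddCommGroup E]
    [InnerProductSpace ℂ E] [FiniteDimensional ℂ E] (T : E →ₗ[ℂ] E)
    (hT : ∀ x y, inner ℂ (T x) (T y) = inner ℂ x y) {n : ℕ} (hn : Module.finrank ℂ E = n) :
    ∃ (b : OrthonormalBasis (Fin n) ℂ E) (z : Fin n → ℂ),
      ∀ i, ‖z i‖ = 1 ∧ T (b i) = z i • b i := by
  classical
  have hnorm : ∀ x, ‖T x‖ = ‖x‖ := fun x => by
    rw [@norm_eq_sqrt_re_inner ℂ, @norm_eq_sqrt_re_inner ℂ, hT]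
  have hunit : ∀ (z : ℂ) (v : E), v ≠ 0 → T v = z • v → ‖z‖ = 1 := by
    intro z v hv h
    have h1 := hnorm v
    rw [h, norm_smul] at h1
    exact mul_right_cancel₀ (norm_ne_zero_iff.mpr hv) (by rw [h1, one_mul])
  have hfam : OrthogonalFamily ℂ (fun z : Eigenvalues T => eigenspace T (z : ℂ))
      fun z => (eigenspace T (z : ℂ)).subtypeₗᵢ := by
    refine OrthogonalFamily.of_pairwise fun z w hzw v hv x hx => ?_
    by_cases hx0 : v = 0
    · simp [hx0]
    have hz1 := hunit _ _ hx0 (mem_eigenspace_iff.mp hv)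
    have h := hT x v
    rw [mem_eigenspace_iff.mp hv, mem_eigenspace_iff.mp hx, inner_smul_left,
      inner_smul_right] at h
    by_contra hne
    have h2 : (starRingEnd ℂ) (w : ℂ) * (z : ℂ) = 1 :=
      mul_right_cancel₀ hne (by rw [mul_assoc, h, one_mul])
    have hx1 : x ≠ 0 := fun h => hne (by simp [h])
    have hw1 := hunit _ _ hx1 (mem_eigenspace_iff.mp hx)
    have h3 : (w : ℂ) * (starRingEnd ℂ) (w : ℂ) = 1 := by
      rw [Complex.mul_conj, Complex.normSq_eq_norm_sq, hw1]; simp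
    apply hzw
    apply Subtype.ext
    calc (z : ℂ) = (w * (starRingEnd ℂ) (w : ℂ)) * z := by rw [h3, one_mul]
      _ = w * ((starRingEnd ℂ) (w : ℂ) * z) := by ring
      _ = w := by rw [h2, mul_one]
  have hint : DirectSum.IsInternal (fun z : Eigenvalues T => eigenspace T (z : ℂ)) := by
    rw [hfam.isInternal_iff]
    change (⨆ z : {z // eigenspace T z ≠ ⊥}, eigenspace T z)ᗮ = ⊥
    rw [iSup_ne_bot_subtype, orthogonal_iSup_eigenspace_eq_bot_of_isometry T hT]
  refine ⟨hint.subordinateOrthonormalBasis hn hfam,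
    fun i => (hint.subordinateOrthonormalBasisIndex hn i hfam : Eigenvalues T), fun i => ?_⟩
  have h := mem_eigenspace_iff.mp (hint.subordinateOrthonormalBasis_subordinate hn i hfam)
  exact ⟨hunit _ _ ((hint.subordinateOrthonormalBasis hn hfam).orthonormal.ne_zero i) h, h⟩

theorem exists_unitary_diagonalization {n : ℕ} {U : Matrix (Fin n) (Fin n) ℂ}
    (hU : U ∈ Matrix.unitaryGroup (Fin n) ℂ) :
    ∃ V ∈ Matrix.unitaryGroup (Fin n) ℂ, ∃ z : Fin n → ℂ, (∀ i, ‖z i‖ = 1) ∧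
      U = V * Matrix.diagonal z * star V := by
  have hT : ∀ x y, inner ℂ (Matrix.toEuclideanLin U x) (Matrix.toEuclideanLin U y)
      = inner ℂ x y := by
    intro x y
    rw [← LinearMap.adjoint_inner_right, ← Matrix.toEuclideanLin_conjTranspose_eq_adjoint]
    congr 1
    rw [← LinearMap.comp_apply, ← Matrix.toLpLin_mul_same]
    have := (Matrix.mem_unitaryGroup_iff'.mp hU)
    rw [Matrix.star_eq_conjTranspose] at this
    simp [this]
  obtain ⟨b, z, hb⟩ := exists_orthonormalBasis_eigenvectors_of_isometry
    (Matrix.toEuclideanLin U) hT (n := n) (by simp)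
  set V := (EuclideanSpace.basisFun (Fin n) ℂ).toBasis.toMatrix b with hVdef
  have hV : V ∈ Matrix.unitaryGroup (Fin n) ℂ :=
    (EuclideanSpace.basisFun (Fin n) ℂ).toMatrix_orthonormalBasis_mem_unitary b
  refine ⟨V, hV, z, fun i => (hb i).1, ?_⟩
  have hUV : U * V = V * Matrix.diagonal z := by
    ext i j
    have h := congrArg (fun v : EuclideanSpace ℂ (Fin n) => v i) (hb j).2
    simp only [Matrix.toLpLin_apply, PiLp.smul_apply, smul_eq_mul] at h
    rw [Matrix.mul_diagonal, Matrix.mul_apply]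
    simp only [hVdef, Module.Basis.toMatrix_apply, OrthonormalBasis.coe_toBasis_repr_apply,
      EuclideanSpace.basisFun_repr]
    rw [mul_comm, ← h]
    rfl
  rw [← hUV, mul_assoc, Matrix.mem_unitaryGroup_iff.mp hV, mul_one]

theorem exists_perm_forall_doublyStochastic_sum_le {n : ℕ} (cost : Fin n → Fin n → ℝ) :
    ∃ σ : Equiv.Perm (Fin n), ∀ D ∈ doublyStochastic ℝ (Fin n),
      ∑ i, cost i (σ i) ≤ ∑ i, ∑ j, D i j * cost i j := by
  obtain ⟨σ, hσ⟩ := Finite.exists_min (fun σ : Equiv.Perm (Fin n) => ∑ i, cost i (σ i))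
  refine ⟨σ, fun D hD => ?_⟩
  obtain ⟨w, hw0, hw1, hw⟩ := exists_eq_sum_perm_of_mem_doublyStochastic hD
  have hperm : ∀ τ : Equiv.Perm (Fin n),
      ∑ i, ∑ j, τ.permMatrix ℝ i j * cost i j = ∑ i, cost i (τ i) := by
    intro τ
    refine Finset.sum_congr rfl fun i _ => ?_
    simp [Equiv.Perm.permMatrix, PEquiv.toMatrix_apply]
  calc ∑ i, cost i (σ i) = ∑ τ, w τ * ∑ i, cost i (σ i) := by
        rw [← Finset.sum_mul, hw1, one_mul]
    _ ≤ ∑ τ, w τ * ∑ i, cost i (τ i) :=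
        Finset.sum_le_sum fun τ _ => mul_le_mul_of_nonneg_left (hσ τ) (hw0 τ)
    _ = ∑ i, ∑ j, D i j * cost i j := by
        simp_rw [← hperm, ← hw, Matrix.sum_apply, Matrix.smul_apply, smul_eq_mul,
          Finset.mul_sum, Finset.sum_mul]
        rw [Finset.sum_comm]
        refine Finset.sum_congr rfl fun i _ => ?_
        rw [Finset.sum_comm]
        simp_rw [mul_assoc]

/-- A substochastic matrix can be completed to a doubly stochastic one. -/
theorem exists_doublyStochastic_sum_le {n : ℕ} {K : ℝ} {C cost : Fin n → Fin n → ℝ}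
    (hC : ∀ i j, 0 ≤ C i j) (hrow : ∀ i, ∑ j, C i j ≤ 1) (hcol : ∀ j, ∑ i, C i j ≤ 1)
    (hcost : ∀ i j, cost i j ≤ K) :
    ∃ D ∈ doublyStochastic ℝ (Fin n), ∑ i, ∑ j, D i j * cost i j ≤
      ∑ i, ∑ j, C i j * cost i j + K * (n - ∑ i, ∑ j, C i j) := by
  set r : Fin n → ℝ := fun i => 1 - ∑ j, C i j with hr
  set s : Fin n → ℝ := fun j => 1 - ∑ i, C i j with hs
  set R : ℝ := n - ∑ i, ∑ j, C i j with hR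
  have hr0 : ∀ i, 0 ≤ r i := fun i => sub_nonneg.mpr (hrow i)
  have hs0 : ∀ i, 0 ≤ s i := fun i => sub_nonneg.mpr (hcol i)
  have hrR : ∑ i, r i = R := by simp [hr, hR]
  have hsR : ∑ i, s i = R := by
    rw [hR, Finset.sum_comm]; simp [hs]
  have hR0 : 0 ≤ R := hrR ▸ Finset.sum_nonneg fun i _ => hr0 i
  have hrR' : ∀ i, r i * R / R = r i := by
    intro i
    by_cases h : R = 0
    · have : r i = 0 := by
        rw [h] at hrR
        exact (Finset.sum_eq_zero_iff_of_nonneg fun i _ => hr0 i).mp hrR i (Finset.mem_univ i)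
      simp [this]
    · field_simp
  have hsR' : ∀ i, R * s i / R = s i := by
    intro i
    by_cases h : R = 0
    · have : s i = 0 := by
        rw [h] at hsR
        exact (Finset.sum_eq_zero_iff_of_nonneg fun i _ => hs0 i).mp hsR i (Finset.mem_univ i)
      simp [this]
    · field_simp
  refine ⟨Matrix.of fun i j => C i j + r i * s j / R, ?_, ?_⟩
  · rw [mem_doublyStochastic_iff_sum]
    refine ⟨fun i j => ?_, fun i => ?_, fun j => ?_⟩
    · have := hC i j; have := hr0 i; have := hs0 j
      simp only [Matrix.of_apply]; positivity
    · simp only [Matrix.of_apply]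
      rw [Finset.sum_add_distrib, ← Finset.sum_div, ← Finset.mul_sum, hsR, hrR']
      simp [hr]
    · simp only [Matrix.of_apply]
      rw [Finset.sum_add_distrib, ← Finset.sum_div, ← Finset.sum_mul, hrR, hsR']
      simp [hs]
  · simp only [Matrix.of_apply, add_mul, Finset.sum_add_distrib]
    gcongr
    calc ∑ i, ∑ j, r i * s j / R * cost i j ≤ ∑ i, ∑ j, r i * s j / R * K := by
          gcongr with i _ j _
          · have := hr0 i; have := hs0 j; positivity
          · exact hcost i j
      _ = K * R := by
          simp_rw [← Finset.sum_mul, ← Finset.sum_div, ← Finset.mul_sum, hsR, ← Finset.sum_mul]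
          rw [hrR, mul_self_div_self, mul_comm]

theorem exists_doublyStochastic_sum_le_of_partition {n : ℕ} {J : Type*} [Fintype J] {K : ℝ}
    (hK : 0 ≤ K)
    {a b g h : J → Fin n → ℝ} {cost : Fin n → Fin n → ℝ}
    (ha : ∀ j i, 0 ≤ a j i) (hb : ∀ j i, 0 ≤ b j i)
    (ha1 : ∀ i, ∑ j, a j i = 1) (hb1 : ∀ i, ∑ j, b j i = 1)
    (hg : ∀ j i, 0 ≤ g j i) (hh : ∀ j i, 0 ≤ h j i)
    (hcost : ∀ i j, cost i j ≤ K) (hgh : ∀ j i i', cost i i' ≤ g j i + h j i') :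
    ∃ D ∈ doublyStochastic ℝ (Fin n), ∑ i, ∑ j, D i j * cost i j ≤
      ∑ j, ∑ i, a j i * g j i + ∑ j, ∑ i, b j i * h j i
        + K * ∑ j, |∑ i, a j i - ∑ i, b j i| := by
  set A : J → ℝ := fun j => ∑ i, a j i with hA
  set B : J → ℝ := fun j => ∑ i, b j i with hB
  have hA0 : ∀ j, 0 ≤ A j := fun j => Finset.sum_nonneg fun i _ => ha j i
  have hB0 : ∀ j, 0 ≤ B j := fun j => Finset.sum_nonneg fun i _ => hb j i
  have hM0 : ∀ j, 0 ≤ max (A j) (B j) := fun j => le_max_of_le_left (hA0 j)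
  have hAM : ∀ j, A j / max (A j) (B j) ≤ 1 := fun j =>
    div_le_one_of_le₀ (le_max_left _ _) (hM0 j)
  have hBM : ∀ j, B j / max (A j) (B j) ≤ 1 := fun j =>
    div_le_one_of_le₀ (le_max_right _ _) (hM0 j)
  set C : Fin n → Fin n → ℝ := fun i i' => ∑ j, a j i * b j i' / max (A j) (B j) with hCdef
  have hrow : ∀ i, ∑ i', C i i' = ∑ j, a j i * (B j / max (A j) (B j)) := by
    intro i
    simp only [hCdef]
    rw [Finset.sum_comm]
    refine Finset.sum_congr rfl fun j _ => ?_
    rw [← Finset.sum_div, ← Finset.mul_sum, mul_div_assoc]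
  have hcol : ∀ i', ∑ i, C i i' = ∑ j, b j i' * (A j / max (A j) (B j)) := by
    intro i
    simp only [hCdef]
    rw [Finset.sum_comm]
    refine Finset.sum_congr rfl fun j _ => ?_
    rw [← Finset.sum_div, ← Finset.sum_mul, mul_comm, mul_div_assoc]
  obtain ⟨D, hD, hle⟩ := exists_doublyStochastic_sum_le (K := K) (C := C) (cost := cost)
    (fun i i' => Finset.sum_nonneg fun j _ =>
      div_nonneg (mul_nonneg (ha j i) (hb j i')) (hM0 j))
    (fun i => by
      rw [hrow, ← ha1 i]
      exact Finset.sum_le_sum fun j _ => mul_le_of_le_one_right (ha j i) (hBM j))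
    (fun i => by
      rw [hcol, ← hb1 i]
      exact Finset.sum_le_sum fun j _ => mul_le_of_le_one_right (hb j i) (hAM j))
    hcost
  refine ⟨D, hD, hle.trans (add_le_add ?_ (mul_le_mul_of_nonneg_left ?_ hK))⟩
  · calc ∑ i, ∑ i', C i i' * cost i i'
        ≤ ∑ i, ∑ i', ∑ j, (a j i * g j i * (b j i' / max (A j) (B j))
            + b j i' * h j i' * (a j i / max (A j) (B j))) := by
          gcongr with i _ i' _
          rw [hCdef, Finset.sum_mul]
          gcongr with j _
          calc _ ≤ a j i * b j i' / max (A j) (B j) * (g j i + h j i') :=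
                mul_le_mul_of_nonneg_left (hgh j i i')
                  (div_nonneg (mul_nonneg (ha j i) (hb j i')) (hM0 j))
            _ = _ := by ring
      _ = ∑ j, ∑ i, a j i * g j i * (B j / max (A j) (B j))
          + ∑ j, ∑ i', b j i' * h j i' * (A j / max (A j) (B j)) := by
          simp_rw [Finset.sum_add_distrib]
          congr 1
          · simp_rw [Finset.sum_comm (t := (Finset.univ : Finset J))]
            simp_rw [← Finset.mul_sum, ← Finset.sum_div]
            rfl
          · rw [Finset.sum_comm]
            simp_rw [Finset.sum_comm (t := (Finset.univ : Finset J))]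
            simp_rw [← Finset.mul_sum, ← Finset.sum_div]
            rfl
      _ ≤ _ := by
          refine add_le_add (Finset.sum_le_sum fun j _ => Finset.sum_le_sum fun i _ => ?_)
            (Finset.sum_le_sum fun j _ => Finset.sum_le_sum fun i _ => ?_)
          · exact mul_le_of_le_one_right (mul_nonneg (ha j i) (hg j i)) (hBM j)
          · exact mul_le_of_le_one_right (mul_nonneg (hb j i) (hh j i)) (hAM j)
  · have hn : (n : ℝ) = ∑ j, A j := by
      simp only [hA]
      rw [Finset.sum_comm]
      simp [ha1]
    have htot : ∑ i, ∑ i', C i i' = ∑ j, A j * (B j / max (A j) (B j)) := by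
      simp_rw [hrow]
      rw [Finset.sum_comm]
      simp_rw [← Finset.sum_mul]
      rfl
    rw [htot, hn, ← Finset.sum_sub_distrib]
    gcongr with j _
    rcases le_total (A j) (B j) with h | h
    · rw [max_eq_right h]
      by_cases hB0' : B j = 0
      · have : A j = 0 := le_antisymm (hB0' ▸ h) (hA0 j)
        simp [this]
      · rw [div_self hB0', mul_one, sub_self]; positivity
    · rw [max_eq_left h]
      by_cases hA0' : A j = 0
      · simp [hA0']
      · rw [mul_div_cancel₀ _ hA0']; exact le_abs_self _
section

open ComplexConjugate

/-- The Fejér kernel of degree `d` centred at `w`, normalized so that its translates by the `d`-th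
roots of unity sum to `1`. -/
noncomputable def fejer (d : ℕ) (w z : ℂ) : ℝ :=
  ‖∑ l ∈ Finset.range d, (z * conj w) ^ l‖ ^ 2 / (d : ℝ) ^ 2

theorem fejer_nonneg (d : ℕ) (w z : ℂ) : 0 ≤ fejer d w z := by
  unfold fejer; positivity

theorem Complex.mul_conj_eq_one {z : ℂ} (hz : ‖z‖ = 1) : z * conj z = 1 := by
  rw [Complex.mul_conj, Complex.normSq_eq_norm_sq, hz]; simp

theorem fejer_eq (d : ℕ) (w z : ℂ) :
    (fejer d w z : ℂ) = (∑ l ∈ Finset.range d, ∑ m ∈ Finset.range d,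
      (conj w ^ l * w ^ m) * (z ^ l * conj z ^ m)) / (d : ℂ) ^ 2 := by
  unfold fejer
  push_cast
  rw [← Complex.mul_conj', map_sum, Finset.sum_mul_sum]
  congr 1
  refine Finset.sum_congr rfl fun l _ => Finset.sum_congr rfl fun m _ => ?_
  simp only [map_pow, map_mul, Complex.conj_conj, mul_pow]
  ring

theorem fejer_mul_norm_sub_sq_le {d : ℕ} {w z : ℂ} (hw : ‖w‖ = 1) (hz : ‖z‖ = 1) :
    fejer d w z * ‖z - w‖ ^ 2 ≤ 4 / (d : ℝ) ^ 2 := by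
  have h1 : ‖z - w‖ = ‖z * conj w - 1‖ := by
    have : z * conj w - 1 = (z - w) * conj w := by
      rw [sub_mul, Complex.mul_conj_eq_one hw]
    rw [this, norm_mul, Complex.norm_conj, hw, mul_one]
  unfold fejer
  rw [h1, div_mul_eq_mul_div, ← mul_pow, ← norm_mul, geom_sum_mul]
  have h2 : ‖(z * conj w) ^ d - 1‖ ≤ 2 := by
    refine (norm_sub_le _ _).trans ?_
    rw [norm_pow, norm_mul, Complex.norm_conj, hw, hz]
    norm_num
  gcongr
  nlinarith [norm_nonneg ((z * conj w) ^ d - 1)]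

theorem sum_fejer_eq_one {d : ℕ} (hd : 0 < d) {ζ : ℂ} (hζ : IsPrimitiveRoot ζ d) {z : ℂ}
    (hz : ‖z‖ = 1) : ∑ j : Fin d, fejer d (ζ ^ (j : ℕ)) z = 1 := by
  have hζ1 : ‖ζ‖ = 1 := hζ.norm'_eq_one hd.ne'
  have hd' : (d : ℂ) ≠ 0 := by exact_mod_cast hd.ne'
  have hsum : ∀ l ∈ Finset.range d, ∀ m ∈ Finset.range d,
      ∑ j ∈ Finset.range d, (conj ζ ^ l * ζ ^ m) ^ j = if l = m then (d : ℂ) else 0 := by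
    intro l hl m hm
    split_ifs with h
    · subst h
      rw [← mul_pow, mul_comm, Complex.mul_conj_eq_one hζ1]
      simp
    · have hne : conj ζ ^ l * ζ ^ m ≠ 1 := by
        intro h1
        apply h
        refine hζ.pow_inj (Finset.mem_range.mp hl) (Finset.mem_range.mp hm) ?_
        calc ζ ^ l = ζ ^ l * (conj ζ ^ l * ζ ^ m) := by rw [h1, mul_one]
          _ = (ζ * conj ζ) ^ l * ζ ^ m := by ring
          _ = ζ ^ m := by rw [Complex.mul_conj_eq_one hζ1, one_pow, one_mul]
      have h0 : (∑ j ∈ Finset.range d, (conj ζ ^ l * ζ ^ m) ^ j) *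
          (conj ζ ^ l * ζ ^ m - 1) = 0 := by
        rw [geom_sum_mul, mul_pow, ← pow_mul, ← pow_mul, mul_comm l, mul_comm m, pow_mul, pow_mul,
          ← map_pow, hζ.pow_eq_one]
        simp
      exact (mul_eq_zero.mp h0).resolve_right (sub_ne_zero.mpr hne)
  have key : (∑ j : Fin d, (fejer d (ζ ^ (j : ℕ)) z : ℂ)) = 1 := by
    rw [Fin.sum_univ_eq_sum_range (fun j => (fejer d (ζ ^ j) z : ℂ)) d]
    simp_rw [fejer_eq]
    rw [← Finset.sum_div, Finset.sum_comm]
    simp_rw [Finset.sum_comm (s := Finset.range d) (f := fun j m => _ * (z ^ _ * conj z ^ m)),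
      ← Finset.sum_mul]
    rw [Finset.sum_congr rfl fun l hl => Finset.sum_congr rfl fun m hm => by
      rw [Finset.sum_congr rfl fun j _ =>
        show conj (ζ ^ j) ^ l * (ζ ^ j) ^ m = (conj ζ ^ l * ζ ^ m) ^ j by
          rw [map_pow]; ring, hsum l hl m hm]]
    rw [Finset.sum_congr rfl fun l hl => by
      simp only [ite_mul, zero_mul]
      rw [Finset.sum_ite_eq, if_pos hl, ← mul_pow, Complex.mul_conj_eq_one hz, one_pow, mul_one]]
    rw [Finset.sum_const, Finset.card_range, nsmul_eq_mul]
    field_simp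
  exact_mod_cast key

theorem norm_sum_pow_mul_conj_pow_sub {n : ℕ} {z w : Fin n → ℂ} (hz : ∀ i, ‖z i‖ = 1)
    (hw : ∀ i, ‖w i‖ = 1) (l m : ℕ) :
    ‖∑ i, z i ^ l * conj (z i) ^ m - ∑ i, w i ^ l * conj (w i) ^ m‖
      = ‖∑ i, z i ^ ((l - m) + (m - l)) - ∑ i, w i ^ ((l - m) + (m - l))‖ := by
  rcases le_total l m with h | h
  · have key : ∀ x : ℂ, ‖x‖ = 1 → x ^ l * conj x ^ m = conj (x ^ (m - l)) := by
      intro x hx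
      rw [← Nat.add_sub_cancel' h, pow_add, ← mul_assoc, ← mul_pow, Complex.mul_conj_eq_one hx]
      simp
    simp_rw [key _ (hz _), key _ (hw _), Nat.sub_eq_zero_of_le h, zero_add, ← map_sum, ← map_sub,
      Complex.norm_conj]
  · have key : ∀ x : ℂ, ‖x‖ = 1 → x ^ l * conj x ^ m = x ^ (l - m) := by
      intro x hx
      rw [← Nat.sub_add_cancel h, pow_add, mul_assoc, ← mul_pow, Complex.mul_conj_eq_one hx]
      simp
    simp_rw [key _ (hz _), key _ (hw _), Nat.sub_eq_zero_of_le h, add_zero]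

theorem abs_sum_fejer_sub_le {n d : ℕ} {z w : Fin n → ℂ} (hz : ∀ i, ‖z i‖ = 1)
    (hw : ∀ i, ‖w i‖ = 1) {x : ℂ} (hx : ‖x‖ = 1) :
    |∑ i, fejer d x (z i) - ∑ i, fejer d x (w i)| ≤
      (∑ l ∈ Finset.range d, ∑ m ∈ Finset.range d,
        ‖∑ i, z i ^ ((l - m) + (m - l)) - ∑ i, w i ^ ((l - m) + (m - l))‖) / (d : ℝ) ^ 2 := by
  have hrw : ∀ z : Fin n → ℂ, ∑ i, (fejer d x (z i) : ℂ) =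
      (∑ l ∈ Finset.range d, ∑ m ∈ Finset.range d,
        (conj x ^ l * x ^ m) * ∑ i, z i ^ l * conj (z i) ^ m) / (d : ℂ) ^ 2 := by
    intro z
    simp_rw [fejer_eq]
    rw [← Finset.sum_div, Finset.sum_comm]
    simp_rw [Finset.sum_comm (s := (Finset.univ : Finset (Fin n))), ← Finset.mul_sum]
  rw [← Real.norm_eq_abs, ← Complex.norm_real]
  push_cast
  rw [hrw, hrw, ← sub_div, norm_div, norm_pow, Complex.norm_natCast]
  gcongr
  simp_rw [← Finset.sum_sub_distrib, ← mul_sub]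
  refine (norm_sum_le _ _).trans (Finset.sum_le_sum fun l _ => ?_)
  refine (norm_sum_le _ _).trans (Finset.sum_le_sum fun m _ => ?_)
  rw [norm_mul, norm_mul, norm_pow, norm_pow, Complex.norm_conj, hx]
  simp only [one_pow, one_mul]
  have := (norm_sum_pow_mul_conj_pow_sub hz hw l m).le
  simpa only [Finset.sum_sub_distrib] using this

/-- Two families of `n` points of the unit circle whose power sums are close can be matched. -/
theorem exists_perm_sum_norm_sub_sq_le {n : ℕ} {z w : Fin n → ℂ} (hz : ∀ i, ‖z i‖ = 1)
    (hw : ∀ i, ‖w i‖ = 1) : ∃ σ : Equiv.Perm (Fin n), ∀ d : ℕ, 0 < d →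
      ∑ i, ‖z i - w (σ i)‖ ^ 2 ≤ n * (16 / d) +
        4 * ((∑ l ∈ Finset.range d, ∑ m ∈ Finset.range d,
          ‖∑ i, z i ^ ((l - m) + (m - l)) - ∑ i, w i ^ ((l - m) + (m - l))‖) / d) := by
  obtain ⟨σ, hσ⟩ := exists_perm_forall_doublyStochastic_sum_le
    (fun i j : Fin n => ‖z i - w j‖ ^ 2)
  refine ⟨σ, fun d hd => ?_⟩
  have hd' : (0 : ℝ) < d := by exact_mod_cast hd
  obtain ⟨ζ, hζ⟩ : ∃ ζ : ℂ, IsPrimitiveRoot ζ d := ⟨_, Complex.isPrimitiveRoot_exp d hd.ne'⟩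
  have hζ1 : ∀ j : Fin d, ‖ζ ^ (j : ℕ)‖ = 1 := fun j => by
    rw [norm_pow, hζ.norm'_eq_one hd.ne', one_pow]
  have hcost : ∀ i j, ‖z i - w j‖ ^ 2 ≤ 4 := by
    intro i j
    have : ‖z i - w j‖ ≤ 2 := (norm_sub_le _ _).trans (by rw [hz, hw]; norm_num)
    nlinarith [norm_nonneg (z i - w j)]
  have htri : ∀ (j : Fin d) (i i' : Fin n), ‖z i - w i'‖ ^ 2 ≤
      2 * ‖z i - ζ ^ (j : ℕ)‖ ^ 2 + 2 * ‖w i' - ζ ^ (j : ℕ)‖ ^ 2 := by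
    intro j i i'
    have h1 : ‖z i - w i'‖ ≤ ‖z i - ζ ^ (j : ℕ)‖ + ‖w i' - ζ ^ (j : ℕ)‖ := by
      rw [norm_sub_rev (w i')]
      exact norm_sub_le_norm_sub_add_norm_sub _ _ _
    nlinarith [norm_nonneg (z i - w i'), sq_nonneg (‖z i - ζ ^ (j : ℕ)‖ - ‖w i' - ζ ^ (j : ℕ)‖)]
  obtain ⟨D, hD, hle⟩ := exists_doublyStochastic_sum_le_of_partition (by norm_num)
    (fun (j : Fin d) i => fejer_nonneg d (ζ ^ (j : ℕ)) (z i))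
    (fun (j : Fin d) i => fejer_nonneg d (ζ ^ (j : ℕ)) (w i))
    (fun i => sum_fejer_eq_one hd hζ (hz i)) (fun i => sum_fejer_eq_one hd hζ (hw i))
    (fun j i => by positivity) (fun j i => by positivity) hcost htri
  have hmass : ∀ x : Fin n → ℂ, (∀ i, ‖x i‖ = 1) →
      ∑ j : Fin d, ∑ i, fejer d (ζ ^ (j : ℕ)) (x i) * (2 * ‖x i - ζ ^ (j : ℕ)‖ ^ 2)
        ≤ (n : ℝ) * (8 / d) := by
    intro x hx
    calc _ ≤ ∑ _j : Fin d, ∑ _i : Fin n, 2 * (4 / (d : ℝ) ^ 2) := by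
          refine Finset.sum_le_sum fun j _ => Finset.sum_le_sum fun i _ => ?_
          rw [mul_left_comm]
          gcongr
          exact fejer_mul_norm_sub_sq_le (hζ1 j) (hx i)
      _ = (n : ℝ) * (8 / d) := by
          simp only [Finset.sum_const, Finset.card_univ, Fintype.card_fin, nsmul_eq_mul]
          field_simp
          ring
  have hdiff : ∑ j : Fin d, |∑ i, fejer d (ζ ^ (j : ℕ)) (z i) - ∑ i, fejer d (ζ ^ (j : ℕ)) (w i)|
      ≤ (∑ l ∈ Finset.range d, ∑ m ∈ Finset.range d,
          ‖∑ i, z i ^ ((l - m) + (m - l)) - ∑ i, w i ^ ((l - m) + (m - l))‖) / d := by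
    refine (Finset.sum_le_sum fun j _ => abs_sum_fejer_sub_le hz hw (hζ1 j)).trans_eq ?_
    simp only [Finset.sum_const, Finset.card_univ, Fintype.card_fin, nsmul_eq_mul]
    field_simp
  have := (hσ D hD).trans hle
  have h1 := hmass z hz
  have h2 := hmass w hw
  have h3 : (n : ℝ) * (16 / d) = n * (8 / d) + n * (8 / d) := by ring
  linarith

end

theorem trNorm_sq {n : ℕ} (A : Matrix (Fin n) (Fin n) ℂ) :
    trNorm A ^ 2 = (∑ i, ∑ j, Complex.normSq (A i j)) / n :=
  Real.sq_sqrt (div_nonneg (Finset.sum_nonneg fun _ _ => Finset.sum_nonneg fun _ _ =>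
    Complex.normSq_nonneg _) (Nat.cast_nonneg n))

theorem trNorm_nonneg {n : ℕ} (A : Matrix (Fin n) (Fin n) ℂ) : 0 ≤ trNorm A :=
  Real.sqrt_nonneg _

theorem sum_normSq_eq_trace {n : ℕ} (A : Matrix (Fin n) (Fin n) ℂ) :
    ((∑ i, ∑ j, Complex.normSq (A i j) : ℝ) : ℂ) = Matrix.trace (A * star A) := by
  push_cast
  simp [Matrix.trace, Matrix.mul_apply, Matrix.star_apply, Complex.mul_conj]

theorem trNorm_mul_unitary {n : ℕ} (A : Matrix (Fin n) (Fin n) ℂ) {U : Matrix (Fin n) (Fin n) ℂ}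
    (hU : U ∈ Matrix.unitaryGroup (Fin n) ℂ) : trNorm (A * U) = trNorm A := by
  unfold trNorm
  congr 2
  rw [← Complex.ofReal_inj, sum_normSq_eq_trace, sum_normSq_eq_trace, star_mul, mul_assoc,
    ← mul_assoc U, Matrix.mem_unitaryGroup_iff.mp hU, one_mul]

theorem trNorm_unitary_mul {n : ℕ} (A : Matrix (Fin n) (Fin n) ℂ) {U : Matrix (Fin n) (Fin n) ℂ}
    (hU : U ∈ Matrix.unitaryGroup (Fin n) ℂ) : trNorm (U * A) = trNorm A := by
  unfold trNorm
  congr 2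
  rw [← Complex.ofReal_inj, sum_normSq_eq_trace, sum_normSq_eq_trace, star_mul, mul_assoc,
    Matrix.trace_mul_comm, mul_assoc, mul_assoc, Matrix.mem_unitaryGroup_iff'.mp hU, mul_one]

theorem nTr_unitary_conj {n : ℕ} (A : Matrix (Fin n) (Fin n) ℂ) {U : Matrix (Fin n) (Fin n) ℂ}
    (hU : U ∈ Matrix.unitaryGroup (Fin n) ℂ) : nTr (U * A * star U) = nTr A := by
  unfold nTr
  rw [Matrix.trace_mul_comm, ← mul_assoc, Matrix.mem_unitaryGroup_iff'.mp hU, one_mul]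

theorem unitary_conj_pow {n : ℕ} (A : Matrix (Fin n) (Fin n) ℂ) {U : Matrix (Fin n) (Fin n) ℂ}
    (hU : U ∈ Matrix.unitaryGroup (Fin n) ℂ) (m : ℕ) :
    (U * A * star U) ^ m = U * A ^ m * star U := by
  induction m with
  | zero => simp [Matrix.mem_unitaryGroup_iff.mp hU]
  | succ m ih =>
    rw [pow_succ, ih, pow_succ]
    simp only [mul_assoc]
    rw [← mul_assoc (star U) U, Matrix.mem_unitaryGroup_iff'.mp hU, one_mul]

theorem norm_nTr_le {n : ℕ} (A : Matrix (Fin n) (Fin n) ℂ) : ‖nTr A‖ ≤ trNorm A := by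
  rcases Nat.eq_zero_or_pos n with rfl | hn
  · simp [nTr, trNorm]
  have hn' : (0 : ℝ) < n := by exact_mod_cast hn
  refine le_of_sq_le_sq ?_ (trNorm_nonneg A)
  rw [trNorm_sq, nTr, norm_div, Complex.norm_natCast, div_pow, sq (n : ℝ), ← div_div]
  gcongr
  rw [div_le_iff₀ hn', Matrix.trace]
  calc ‖∑ i, A.diag i‖ ^ 2 ≤ (∑ i, ‖A i i‖) ^ 2 := by gcongr; exact norm_sum_le _ _
    _ ≤ (Finset.univ : Finset (Fin n)).card * ∑ i, ‖A i i‖ ^ 2 := sq_sum_le_card_mul_sum_sq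
    _ = (∑ i, Complex.normSq (A i i)) * n := by
        simp [Complex.normSq_eq_norm_sq, mul_comm]
    _ ≤ _ := by
        gcongr with i _
        exact Finset.single_le_sum (f := fun j => Complex.normSq (A i j))
          (fun j _ => Complex.normSq_nonneg _) (Finset.mem_univ i)

theorem norm_nTr_unitary_le_one {n : ℕ} {U : Matrix (Fin n) (Fin n) ℂ}
    (hU : U ∈ Matrix.unitaryGroup (Fin n) ℂ) : ‖nTr U‖ ≤ 1 := by
  refine (norm_nTr_le U).trans ?_
  rw [← one_mul U, trNorm_mul_unitary _ hU, trNorm, Real.sqrt_le_one]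
  refine div_le_one_of_le₀ (le_of_eq ?_) (Nat.cast_nonneg n)
  simp [Matrix.one_apply, apply_ite]

theorem norm_nTr_pow_sub_pow_le {n : ℕ} {A B : Matrix (Fin n) (Fin n) ℂ}
    (hA : A ∈ Matrix.unitaryGroup (Fin n) ℂ) (hB : B ∈ Matrix.unitaryGroup (Fin n) ℂ) (m : ℕ) :
    ‖nTr (A ^ m) - nTr (B ^ m)‖ ≤ m * trNorm (A - B) := by
  have hsub : ∀ X Y : Matrix (Fin n) (Fin n) ℂ, nTr (X - Y) = nTr X - nTr Y := fun X Y => by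
    simp [nTr, sub_div]
  suffices h : ∀ W ∈ Matrix.unitaryGroup (Fin n) ℂ,
      ‖nTr ((A ^ m - B ^ m) * W)‖ ≤ m * trNorm (A - B) by
    simpa [hsub] using h 1 (one_mem _)
  induction m with
  | zero => intro W _; simp [nTr]
  | succ m ih =>
    intro W hW
    have h1 : (A ^ (m + 1) - B ^ (m + 1)) * W =
        A ^ m * ((A - B) * W) - (B ^ m - A ^ m) * (B * W) := by
      rw [pow_succ, pow_succ]; noncomm_ring
    have h2 : nTr ((B ^ m - A ^ m) * (B * W)) = - nTr ((A ^ m - B ^ m) * (B * W)) := by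
      rw [← neg_sub, neg_mul]; simp [nTr, neg_div]
    rw [h1, hsub, h2, sub_neg_eq_add]
    refine (norm_add_le _ _).trans ?_
    have h3 := ih _ (mul_mem hB hW)
    have h4 := norm_nTr_le (A ^ m * ((A - B) * W))
    rw [trNorm_unitary_mul _ (pow_mem hA m), trNorm_mul_unitary _ hW] at h4
    push_cast
    linarith

theorem nTr_unitary_conj_diagonal_pow {n : ℕ} {V : Matrix (Fin n) (Fin n) ℂ}
    (hV : V ∈ Matrix.unitaryGroup (Fin n) ℂ) (z : Fin n → ℂ) (m : ℕ) :
    nTr ((V * Matrix.diagonal z * star V) ^ m) = (∑ i, z i ^ m) / n := by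
  rw [unitary_conj_pow _ hV, nTr_unitary_conj _ hV, Matrix.diagonal_pow, nTr, Matrix.trace_diagonal]
  rfl

/-- Unitary matrices whose moments are close are close up to unitary conjugation. -/
theorem exists_unitary_conj_trNorm_sub_sq_le {n : ℕ} (hn : 0 < n) {A B : Matrix (Fin n) (Fin n) ℂ}
    (hA : A ∈ Matrix.unitaryGroup (Fin n) ℂ) (hB : B ∈ Matrix.unitaryGroup (Fin n) ℂ) :
    ∃ W ∈ Matrix.unitaryGroup (Fin n) ℂ, ∀ d : ℕ, 0 < d →
      trNorm (W * A * star W - B) ^ 2 ≤ 16 / d +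
        4 * ((∑ l ∈ Finset.range d, ∑ m ∈ Finset.range d,
          ‖nTr (A ^ ((l - m) + (m - l))) - nTr (B ^ ((l - m) + (m - l)))‖) / d) := by
  have hn' : (0 : ℝ) < n := by exact_mod_cast hn
  obtain ⟨V, hV, z, hz, rfl⟩ := exists_unitary_diagonalization hA
  obtain ⟨Q, hQ, w, hw, rfl⟩ := exists_unitary_diagonalization hB
  obtain ⟨σ, hσ⟩ := exists_perm_sum_norm_sub_sq_le hz hw
  set V' : Matrix (Fin n) (Fin n) ℂ := V.submatrix id σ.symm with hV'def
  have hV' : V' ∈ Matrix.unitaryGroup (Fin n) ℂ := by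
    rw [Matrix.mem_unitaryGroup_iff', hV'def, Matrix.star_eq_conjTranspose,
      Matrix.conjTranspose_submatrix, ← Matrix.submatrix_mul _ _ _ _ _ Function.bijective_id,
      ← Matrix.star_eq_conjTranspose, Matrix.mem_unitaryGroup_iff'.mp hV]
    exact Matrix.submatrix_one_equiv σ.symm
  have hVV' : V * Matrix.diagonal z * star V
      = V' * Matrix.diagonal (z ∘ σ.symm) * star V' := by
    have h1 : Matrix.diagonal (z ∘ σ.symm) = (Matrix.diagonal z).submatrix σ.symm σ.symm :=
      (Matrix.submatrix_diagonal_equiv z σ.symm).symm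
    rw [h1, hV'def, Matrix.star_eq_conjTranspose, Matrix.star_eq_conjTranspose,
      Matrix.conjTranspose_submatrix, ← Matrix.submatrix_mul _ _ _ _ _ σ.symm.bijective,
      ← Matrix.submatrix_mul _ _ _ _ _ σ.symm.bijective, Matrix.submatrix_id_id]
  have hW : Q * star V' ∈ Matrix.unitaryGroup (Fin n) ℂ := mul_mem hQ (Unitary.star_mem hV')
  refine ⟨Q * star V', hW, fun d hd => ?_⟩
  have hconj : Q * star V' * (V * Matrix.diagonal z * star V) * star (Q * star V')
      - Q * Matrix.diagonal w * star Q
      = Q * (Matrix.diagonal (z ∘ σ.symm - w) * star Q) := by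
    have h1 : star V' * (V' * (Matrix.diagonal (z ∘ σ.symm) * (star V' * (V' * star Q))))
        = Matrix.diagonal (z ∘ σ.symm) * star Q := by
      rw [← mul_assoc (star V') V', Matrix.mem_unitaryGroup_iff'.mp hV', one_mul,
        ← mul_assoc (star V') V', Matrix.mem_unitaryGroup_iff'.mp hV', one_mul]
    have h2 : Matrix.diagonal (z ∘ σ.symm - w)
        = Matrix.diagonal (z ∘ σ.symm) - Matrix.diagonal w := (Matrix.diagonal_sub _ _).symm
    rw [hVV', star_mul, star_star, h2, sub_mul, mul_sub, ← h1]
    simp only [mul_assoc]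
  have hnorm : trNorm (Q * star V' * (V * Matrix.diagonal z * star V) * star (Q * star V')
      - Q * Matrix.diagonal w * star Q) ^ 2 = (∑ i, ‖z i - w (σ i)‖ ^ 2) / n := by
    rw [hconj, trNorm_unitary_mul _ hQ, trNorm_mul_unitary _ (Unitary.star_mem hQ), trNorm_sq]
    congr 1
    rw [← Equiv.sum_comp σ]
    refine Finset.sum_congr rfl fun i _ => ?_
    rw [Finset.sum_eq_single (σ i)]
    · simp [Complex.normSq_eq_norm_sq]
    · intro j _ hj
      rw [Matrix.diagonal_apply_ne _ hj.symm, map_zero]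
    · simp
  have hmom : ∀ m : ℕ, ‖nTr ((V * Matrix.diagonal z * star V) ^ m)
      - nTr ((Q * Matrix.diagonal w * star Q) ^ m)‖ = ‖∑ i, z i ^ m - ∑ i, w i ^ m‖ / n := by
    intro m
    rw [nTr_unitary_conj_diagonal_pow hV, nTr_unitary_conj_diagonal_pow hQ, ← sub_div, norm_div,
      Complex.norm_natCast]
  simp_rw [hnorm, hmom, ← Finset.sum_div]
  rw [div_le_iff₀ hn']
  refine (hσ d hd).trans_eq ?_
  field_simp

theorem isPermMatrix_of_perm {n : ℕ} (σ : Equiv.Perm (Fin n)) :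
    IsPermMatrix (Matrix.of fun i j => if i = σ j then (1 : ℂ) else 0) :=
  ⟨σ, fun _ _ => rfl⟩

theorem permMatrix_mem_unitaryGroup {n : ℕ} (σ : Equiv.Perm (Fin n)) :
    (Matrix.of fun i j => if i = σ j then (1 : ℂ) else 0) ∈ Matrix.unitaryGroup (Fin n) ℂ := by
  rw [Matrix.mem_unitaryGroup_iff']
  ext i j
  rcases eq_or_ne i j with rfl | h
  · simp [Matrix.mul_apply, Matrix.star_apply, apply_ite]
  · simp [Matrix.mul_apply, Matrix.star_apply, apply_ite, h, h.symm]

theorem permMatrix_pow {n : ℕ} (σ : Equiv.Perm (Fin n)) (m : ℕ) :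
    (Matrix.of fun i j => if i = σ j then (1 : ℂ) else 0) ^ m
      = Matrix.of fun i j => if i = (σ ^ m) j then (1 : ℂ) else 0 := by
  induction m with
  | zero => ext i j; simp [Matrix.one_apply]
  | succ m ih =>
    rw [pow_succ, ih, pow_succ]
    ext i j
    simp only [Matrix.mul_apply, Matrix.of_apply, mul_ite, mul_one, mul_zero,
      Finset.sum_ite_eq', Finset.mem_univ, if_true, Equiv.Perm.mul_apply]
    congr

theorem nTr_permMatrix_pow {n : ℕ} (σ : Equiv.Perm (Fin n)) (m : ℕ) :
    nTr ((Matrix.of fun i j => if i = σ j then (1 : ℂ) else 0) ^ m)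
      = ((Finset.univ.filter fun x => (σ ^ m) x = x).card : ℂ) / n := by
  rw [permMatrix_pow, nTr, Matrix.trace]
  simp [eq_comm]

theorem card_fixedPoints_pow_eq_sum_divisors {α : Type*} [Fintype α] [DecidableEq α]
    (σ : Equiv.Perm α) {m : ℕ} (hm : 0 < m) :
    (Finset.univ.filter fun x => (σ ^ m) x = x).card =
      ∑ d ∈ m.divisors, (Finset.univ.filter fun x => Function.minimalPeriod σ x = d).card := by
  have hiff : ∀ x, (σ ^ m) x = x ↔ Function.minimalPeriod σ x ∣ m := fun x => by
    rw [← Function.isPeriodicPt_iff_minimalPeriod_dvd, Function.IsPeriodicPt, Function.IsFixedPt,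
      Equiv.Perm.iterate_eq_pow]
  rw [Finset.card_eq_sum_card_fiberwise (f := fun x => Function.minimalPeriod σ x)
    (t := m.divisors) fun x hx => by
      simpa [hm.ne'] using (hiff x).mp (by simpa using hx)]
  refine Finset.sum_congr rfl fun d hd => ?_
  congr 1
  ext x
  simp only [Finset.mem_filter, Finset.mem_univ, true_and, hiff, and_iff_right_iff_imp]
  rintro rfl
  exact Nat.dvd_of_mem_divisors hd

open Fin.NatCast Fin.CommRing in
theorem card_fixedPoints_finRotate_pow (a m : ℕ) :
    (Finset.univ.filter fun x => (finRotate a ^ m) x = x).card = if a ∣ m then a else 0 := by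
  cases a with
  | zero => simp
  | succ a =>
    have h : ∀ x : Fin (a + 1), (finRotate (a + 1) ^ m) x = x + (m : Fin (a + 1)) := by
      intro x
      induction m with
      | zero => simp
      | succ m ih => rw [pow_succ', Equiv.Perm.mul_apply, ih, finRotate_apply]; push_cast; ring
    simp only [h, add_eq_left, Fin.natCast_eq_zero]
    split_ifs with h <;> simp [h]

/-- There is a permutation with any prescribed family of cycle lengths. -/
theorem exists_perm_card_fixedPoints_pow {ι : Type*} [Fintype ι] (ℓ : ι → ℕ) {n : ℕ}
    (hn : ∑ i, ℓ i = n) : ∃ σ : Equiv.Perm (Fin n), ∀ m : ℕ,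
      (Finset.univ.filter fun x => (σ ^ m) x = x).card = ∑ i, if ℓ i ∣ m then ℓ i else 0 := by
  classical
  subst hn
  let e : (Σ i, Fin (ℓ i)) ≃ Fin (∑ i, ℓ i) := Fintype.equivFinOfCardEq (by simp)
  let ρ : Equiv.Perm (Σ i, Fin (ℓ i)) := Equiv.Perm.sigmaCongrRight fun i => finRotate (ℓ i)
  have hρ : ∀ (m : ℕ) (x : Σ i, Fin (ℓ i)), (ρ ^ m) x = ⟨x.1, (finRotate (ℓ x.1) ^ m) x.2⟩ := by
    intro m
    induction m with
    | zero => intro x; simp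
    | succ m ih => intro x; rw [pow_succ', Equiv.Perm.mul_apply, ih, pow_succ']; rfl
  have he : ∀ (m : ℕ) (x : Fin (∑ i, ℓ i)), ((e.permCongr ρ) ^ m) x = e ((ρ ^ m) (e.symm x)) := by
    intro m
    induction m with
    | zero => intro x; simp
    | succ m ih => intro x; rw [pow_succ', Equiv.Perm.mul_apply, ih, pow_succ']; simp
  refine ⟨e.permCongr ρ, fun m => ?_⟩
  calc _ = (Finset.univ.filter fun x => (ρ ^ m) x = x).card := by
        refine (Finset.card_equiv e fun x => ?_).symm
        simp [he]
    _ = (Finset.univ.sigma fun i =>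
          Finset.univ.filter fun x => (finRotate (ℓ i) ^ m) x = x).card := by
        congr 1
        ext ⟨i, x⟩
        simp [hρ]
    _ = _ := by
        rw [Finset.card_sigma]
        simp_rw [card_fixedPoints_finRotate_pow]

theorem sum_divisorsAntidiagonal_moebius_eq_sum_powerset (g : ℕ → ℂ) {i : ℕ} (hi : 0 < i) :
    ∑ x ∈ i.divisorsAntidiagonal, (ArithmeticFunction.moebius x.1 : ℂ) * g x.2 =
      ∑ S ∈ i.primeFactors.powerset, (-1 : ℂ) ^ S.card * g (i / ∏ p ∈ S, p) := by
  rw [Nat.sum_divisorsAntidiagonal (fun a b => (ArithmeticFunction.moebius a : ℂ) * g b)]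
  rw [← Finset.sum_filter_of_ne (p := Squarefree) fun d _ h => by
    rw [← ArithmeticFunction.moebius_ne_zero_iff_squarefree]
    rintro h0; simp [h0] at h]
  rw [Nat.sum_divisors_filter_squarefree hi.ne']
  have hfac : (UniqueFactorizationMonoid.normalizedFactors i).toFinset = i.primeFactors := by
    rw [Nat.factors_eq]; rfl
  rw [hfac]
  refine Finset.sum_congr rfl fun S hS => ?_
  have hp : ∀ p ∈ S, p.Prime := fun p h =>
    Nat.prime_of_mem_primeFactors (Finset.mem_powerset.mp hS h)
  rw [Finset.prod_val]
  congr 1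
  have hμ : ArithmeticFunction.moebius (∏ p ∈ S, p) = (-1) ^ S.card := by
    clear hS
    induction S using Finset.induction_on with
    | empty => simp
    | insert q S hq ih =>
      rw [Finset.prod_insert hq, Finset.card_insert_of_notMem hq,
        ArithmeticFunction.isMultiplicative_moebius.map_mul_of_coprime,
        ArithmeticFunction.moebius_apply_prime (hp q (Finset.mem_insert_self _ _)),
        ih fun p h => hp p (Finset.mem_insert_of_mem h), pow_succ']
      refine Nat.Coprime.prod_right fun p h => ?_
      refine (Nat.coprime_primes (hp q (Finset.mem_insert_self _ _))
        (hp p (Finset.mem_insert_of_mem h))).mpr ?_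
      rintro rfl
      exact hq h
  simp only [id]
  rw [hμ]; simp

theorem sum_divisors_eq_iff_eq_sum_powerset {f g : ℕ → ℂ} :
    (∀ m : ℕ, 0 < m → ∑ d ∈ m.divisors, f d = g m) ↔
      ∀ i : ℕ, 0 < i →
        f i = ∑ S ∈ i.primeFactors.powerset, (-1 : ℂ) ^ S.card * g (i / ∏ p ∈ S, p) := by
  refine ArithmeticFunction.sum_eq_iff_sum_mul_moebius_eq.trans
    (forall₂_congr fun i hi => ?_)
  rw [sum_divisorsAntidiagonal_moebius_eq_sum_powerset g hi, eq_comm]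

theorem sum_fin_ite_dvd_eq_sum_divisors {M : Type*} [AddCommMonoid M] (f : ℕ → M) {m n : ℕ}
    (hm : 0 < m) (hmn : m ≤ n) :
    ∑ i : Fin n, (if (i : ℕ) + 1 ∣ m then f (i + 1) else 0) = ∑ d ∈ m.divisors, f d := by
  rw [Fin.sum_univ_eq_sum_range (fun i => if i + 1 ∣ m then f (i + 1) else 0) n,
    ← Finset.sum_filter]
  refine Finset.sum_nbij' (· + 1) (· - 1) (fun i hi => ?_) (fun d hd => ?_) (fun i _ => ?_)
    (fun d hd => ?_) (fun i _ => rfl)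
  · simp only [Finset.mem_filter] at hi
    exact Nat.mem_divisors.2 ⟨hi.2, hm.ne'⟩
  · have h0 := Nat.pos_of_mem_divisors hd
    have h1 := Nat.divisor_le hd
    rw [Finset.mem_filter, Finset.mem_range, Nat.sub_add_cancel h0]
    exact ⟨by omega, Nat.dvd_of_mem_divisors hd⟩
  · exact Nat.add_sub_cancel ..
  · exact Nat.sub_add_cancel (Nat.pos_of_mem_divisors hd)

/-- Given nonnegative cycle densities with sum at most `1`, there is a permutation whose power
traces are close to those prescribed by the densities. -/
theorem exists_perm_abs_card_fixedPoints_sub_le {c : ℕ → ℝ} (hc : ∀ i, 0 < i → 0 ≤ c i)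
    {n : ℕ} (hn : 0 < n) (hsum : ∑ i ∈ Finset.range n, c (i + 1) ≤ 1) :
    ∃ σ : Equiv.Perm (Fin n), ∀ m : ℕ, 0 < m → m ≤ n →
      |((Finset.univ.filter fun x => (σ ^ m) x = x).card : ℝ) / n - ∑ d ∈ m.divisors, c d|
        ≤ (m + ∑ d ∈ m.divisors, (d : ℝ)) / n := by
  have hn' : (0 : ℝ) < n := by exact_mod_cast hn
  set a : ℕ → ℕ := fun d => ⌊c d * n / d⌋₊ with ha
  have ha_le : ∀ d, 0 < d → (a d : ℝ) * d ≤ c d * n := fun d hd => by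
    have hd' : (0 : ℝ) < d := by exact_mod_cast hd
    rw [← le_div_iff₀ hd']
    have := hc d hd
    exact Nat.floor_le (by positivity)
  have le_ha : ∀ d, 0 < d → c d * n ≤ a d * d + d := fun d hd => by
    have hd' : (0 : ℝ) < d := by exact_mod_cast hd
    have := Nat.lt_floor_add_one (c d * n / d)
    rw [div_lt_iff₀ hd'] at this
    simp only [ha]
    linarith
  have hle : ∑ i : Fin n, a (i + 1) * (i + 1) ≤ n := by
    have h : (∑ i : Fin n, (a (i + 1) : ℝ) * ((i + 1 : ℕ) : ℝ)) ≤ n := by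
      calc _ ≤ ∑ i : Fin n, c (i + 1) * n :=
            Finset.sum_le_sum fun i _ => ha_le _ (Nat.succ_pos _)
        _ = (∑ i ∈ Finset.range n, c (i + 1)) * n := by
            rw [← Finset.sum_mul, Fin.sum_univ_eq_sum_range (fun i => c (i + 1)) n]
        _ ≤ n := mul_le_of_le_one_left hn'.le hsum
    exact_mod_cast h
  set r := n - ∑ i : Fin n, a (i + 1) * (i + 1) with hr
  obtain ⟨σ, hσ⟩ := exists_perm_card_fixedPoints_pow (n := n)
    (fun o : Option (Σ i : Fin n, Fin (a (i + 1))) => o.elim r fun x => (x.1 : ℕ) + 1) (by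
      rw [Fintype.sum_option, Fintype.sum_sigma]
      simp only [Option.elim, Finset.sum_const, Finset.card_univ, Fintype.card_fin, smul_eq_mul]
      omega)
  refine ⟨σ, fun m hm hmn => ?_⟩
  have hcard : (Finset.univ.filter fun x => (σ ^ m) x = x).card
      = (if r ∣ m then r else 0) + ∑ d ∈ m.divisors, a d * d := by
    rw [hσ, Fintype.sum_option, Fintype.sum_sigma,
      ← sum_fin_ite_dvd_eq_sum_divisors (fun d => a d * d) hm hmn]
    refine congrArg₂ _ rfl (Finset.sum_congr rfl fun i _ => ?_)
    refine (Finset.sum_const (s := (Finset.univ : Finset (Fin (a (i + 1)))))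
      (if (i : ℕ) + 1 ∣ m then (i : ℕ) + 1 else 0)).trans ?_
    simp
  have hr0 : (0 : ℝ) ≤ ((if r ∣ m then r else 0 : ℕ) : ℝ) := Nat.cast_nonneg _
  have hrm : ((if r ∣ m then r else 0 : ℕ) : ℝ) ≤ m := by
    split_ifs with h
    · exact_mod_cast Nat.le_of_dvd hm h
    · simp
  have h1 : ∑ d ∈ m.divisors, (a d : ℝ) * d ≤ (∑ d ∈ m.divisors, c d) * n := by
    rw [Finset.sum_mul]
    exact Finset.sum_le_sum fun d hd => ha_le d (Nat.pos_of_mem_divisors hd)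
  have h2 : (∑ d ∈ m.divisors, c d) * n ≤
      ∑ d ∈ m.divisors, (a d : ℝ) * d + ∑ d ∈ m.divisors, (d : ℝ) := by
    rw [Finset.sum_mul, ← Finset.sum_add_distrib]
    exact Finset.sum_le_sum fun d hd => le_ha d (Nat.pos_of_mem_divisors hd)
  have h3 : (0 : ℝ) ≤ ∑ d ∈ m.divisors, (d : ℝ) := Finset.sum_nonneg fun d _ => Nat.cast_nonneg d
  rw [hcard, div_sub' hn'.ne', abs_div, abs_of_pos hn']
  gcongr
  push_cast at hr0 hrm ⊢
  rw [abs_le]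
  constructor <;> nlinarith

theorem tendsto_nTr_pow_of_tendsto_trNorm_sub {l : Filter ℕ} {n : ℕ → ℕ}
    {u v : ∀ k, Matrix (Fin (n k)) (Fin (n k)) ℂ}
    (hu : ∀ k, u k ∈ Matrix.unitaryGroup (Fin (n k)) ℂ)
    (hv : ∀ k, v k ∈ Matrix.unitaryGroup (Fin (n k)) ℂ)
    (h : Tendsto (fun k => trNorm (u k - v k)) l (nhds 0)) {m : ℕ} {t : ℂ}
    (ht : Tendsto (fun k => nTr (u k ^ m)) l (nhds t)) :
    Tendsto (fun k => nTr (v k ^ m)) l (nhds t) := by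
  have h0 : Tendsto (fun k => nTr (u k ^ m) - nTr (v k ^ m)) l (nhds 0) :=
    squeeze_zero_norm (fun k => norm_nTr_pow_sub_pow_le (hu k) (hv k) m)
      (by simpa using h.const_mul (m : ℝ))
  simpa using ht.sub h0

theorem exists_unitary_conj_tendsto_trNorm_sub {l : Filter ℕ} {n : ℕ → ℕ} (hn : ∀ k, 0 < n k)
    {u v : ∀ k, Matrix (Fin (n k)) (Fin (n k)) ℂ}
    (hu : ∀ k, u k ∈ Matrix.unitaryGroup (Fin (n k)) ℂ)
    (hv : ∀ k, v k ∈ Matrix.unitaryGroup (Fin (n k)) ℂ)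
    (h : ∀ m : ℕ, 0 < m → Tendsto (fun k => nTr (u k ^ m) - nTr (v k ^ m)) l (nhds 0)) :
    ∃ w : ∀ k, Matrix (Fin (n k)) (Fin (n k)) ℂ,
      (∀ k, w k ∈ Matrix.unitaryGroup (Fin (n k)) ℂ) ∧
      Tendsto (fun k => trNorm (w k * u k * star (w k) - v k)) l (nhds 0) := by
  choose w hw hle using fun k => exists_unitary_conj_trNorm_sub_sq_le (hn k) (hu k) (hv k)
  refine ⟨w, hw, ?_⟩
  have hdiff : ∀ m : ℕ, Tendsto (fun k => ‖nTr (u k ^ m) - nTr (v k ^ m)‖) l (nhds 0) := by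
    intro m
    rcases Nat.eq_zero_or_pos m with rfl | hm
    · simpa using tendsto_const_nhds
    · simpa using (h m hm).norm
  have hsq : Tendsto (fun k => trNorm (w k * u k * star (w k) - v k) ^ 2) l (nhds 0) := by
    rw [tendsto_order]
    refine ⟨fun b hb => Eventually.of_forall fun k => hb.trans_le (sq_nonneg _), fun ε hε => ?_⟩
    obtain ⟨d, hd⟩ := exists_nat_gt (16 / ε)
    have hd0 : (0 : ℝ) < d := (by positivity : (0 : ℝ) ≤ 16 / ε).trans_lt hd
    have hlim : Tendsto (fun k => (16 : ℝ) / d + 4 * ((∑ l ∈ Finset.range d,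
        ∑ m ∈ Finset.range d, ‖nTr (u k ^ ((l - m) + (m - l)))
          - nTr (v k ^ ((l - m) + (m - l)))‖) / d)) l (nhds (16 / d)) := by
      have := ((tendsto_finsetSum (Finset.range d) fun l _ =>
        tendsto_finsetSum (Finset.range d) fun m _ => hdiff ((l - m) + (m - l))).div_const
          (d : ℝ)).const_mul 4 |>.const_add ((16 : ℝ) / d)
      simpa using this
    have hlt : (16 : ℝ) / d < ε := by
      rw [div_lt_iff₀ hd0, mul_comm]
      exact (div_lt_iff₀ hε).mp hd
    filter_upwards [hlim.eventually_lt_const hlt] with k hk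
    exact (hle k d (by exact_mod_cast hd0)).trans_lt hk
  have := hsq.sqrt
  simpa [Real.sqrt_sq (trNorm_nonneg _)] using this

/-- With `ω` a free ultrafilter, `n k → ∞` and `u k` unitary, suppose
`Tr((u k)^m) → τ m` along `ω` for every `m ∈ ℕ*`, and set
`c i = ∑_{S ⊆ primeFactors i} (−1)^|S| τ(i / ∏_{p ∈ S} p)`. Then `u` is conjugated in the
ultraproduct to an ultraproduct of permutation matrices iff every `c i` is a nonnegative
real. -/
theorem conjugate_to_permutations_iff_cyc_nonneg (ω : Ultrafilter ℕ)
    (hω : (ω : Filter ℕ) ≤ Filter.cofinite)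
    (n : ℕ → ℕ) (hn : ∀ k, 0 < n k) (hn' : Tendsto n atTop atTop)
    (u : ∀ k, Matrix (Fin (n k)) (Fin (n k)) ℂ)
    (hu : ∀ k, u k ∈ Matrix.unitaryGroup (Fin (n k)) ℂ)
    (τ : ℕ → ℂ)
    (hτ : ∀ m : ℕ, 0 < m →
      Tendsto (fun k => nTr (u k ^ m)) (ω : Filter ℕ) (nhds (τ m)))
    (c : ℕ → ℂ)
    (hc : ∀ i : ℕ, 0 < i →
      c i = ∑ S ∈ i.primeFactors.powerset, (-1 : ℂ) ^ S.card * τ (i / ∏ p ∈ S, p)) :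
    (∃ (p w : ∀ k, Matrix (Fin (n k)) (Fin (n k)) ℂ),
        (∀ k, IsPermMatrix (p k)) ∧
        (∀ k, w k ∈ Matrix.unitaryGroup (Fin (n k)) ℂ) ∧
        Tendsto (fun k => trNorm (w k * u k * star (w k) - p k)) (ω : Filter ℕ)
          (nhds 0)) ↔
      ∀ i : ℕ, 0 < i → (c i).im = 0 ∧ 0 ≤ (c i).re := by
  constructor
  · rintro ⟨p, w, hp, hw, hlim⟩ i hi
    choose σ hσ using hp
    have hpeq : ∀ k, p k = Matrix.of fun i j => if i = σ k j then (1 : ℂ) else 0 := fun k => by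
      ext i j; exact hσ k i j
    have hpτ : ∀ m : ℕ, 0 < m →
        Tendsto (fun k => nTr (p k ^ m)) (ω : Filter ℕ) (nhds (τ m)) := by
      intro m hm
      refine tendsto_nTr_pow_of_tendsto_trNorm_sub
        (fun k => mul_mem (mul_mem (hw k) (hu k)) (Unitary.star_mem (hw k)))
        (fun k => hpeq k ▸ permMatrix_mem_unitaryGroup (σ k)) hlim ?_
      simpa only [unitary_conj_pow _ (hw _), nTr_unitary_conj _ (hw _)] using hτ m hm
    set e : ℕ → ℕ → ℝ := fun k d =>
      ((Finset.univ.filter fun x => Function.minimalPeriod (σ k) x = d).card : ℝ) / n k with he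
    have hsum : ∀ k, ∀ m : ℕ, 0 < m → ∑ d ∈ m.divisors, (e k d : ℂ) = nTr (p k ^ m) := by
      intro k m hm
      rw [hpeq, nTr_permMatrix_pow, card_fixedPoints_pow_eq_sum_divisors _ hm]
      simp [he, Finset.sum_div]
    have hec : Tendsto (fun k => (e k i : ℂ)) (ω : Filter ℕ) (nhds (c i)) := by
      rw [hc i hi]
      simp_rw [sum_divisors_eq_iff_eq_sum_powerset.mp (hsum _) i hi]
      refine tendsto_finsetSum _ fun S hS => (hpτ _ ?_).const_mul _
      refine Nat.div_pos (Nat.le_of_dvd hi ?_) ?_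
      · exact (Finset.prod_dvd_prod_of_subset _ _ _ (Finset.mem_powerset.mp hS)).trans
          (Nat.prod_primeFactors_dvd i)
      · exact Finset.prod_pos fun p hp =>
          (Nat.prime_of_mem_primeFactors (Finset.mem_powerset.mp hS hp)).pos
    constructor
    · have := (Complex.continuous_im.tendsto _).comp hec
      exact tendsto_nhds_unique this (by simp [Function.comp_def])
    · have := (Complex.continuous_re.tendsto _).comp hec
      refine ge_of_tendsto' this fun k => ?_
      simp only [Function.comp_apply, Complex.ofReal_re, he]
      positivity
  · intro hpos
    have hcτ := sum_divisors_eq_iff_eq_sum_powerset.mpr hc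
    have hcre : ∀ m : ℕ, 0 < m → ((∑ d ∈ m.divisors, (c d).re : ℝ) : ℂ) = τ m := by
      intro m hm
      rw [← hcτ m hm]
      push_cast
      refine Finset.sum_congr rfl fun d hd => ?_
      apply Complex.ext <;> simp [(hpos d (Nat.pos_of_mem_divisors hd)).1]
    have hτ1 : ∀ m : ℕ, 0 < m → ‖τ m‖ ≤ 1 := fun m hm =>
      le_of_tendsto' (hτ m hm).norm fun k => norm_nTr_unitary_le_one (pow_mem (hu k) m)
    have hc1 : ∀ N : ℕ, ∑ i ∈ Finset.range N, (c (i + 1)).re ≤ 1 := by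
      intro N
      have hN := Nat.factorial_pos N
      calc ∑ i ∈ Finset.range N, (c (i + 1)).re
          = ∑ d ∈ (Finset.range N).map (addRightEmbedding 1), (c d).re := by simp
        _ ≤ ∑ d ∈ N.factorial.divisors, (c d).re := by
            refine Finset.sum_le_sum_of_subset_of_nonneg ?_ fun d hd _ =>
              (hpos d (Nat.pos_of_mem_divisors hd)).2
            intro d hd
            obtain ⟨i, hi, rfl⟩ := Finset.mem_map.mp hd
            exact Nat.mem_divisors.mpr ⟨Nat.dvd_factorial (Nat.succ_pos i)
              (Finset.mem_range.mp hi), hN.ne'⟩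
        _ ≤ ‖τ N.factorial‖ := by
            rw [← hcre _ hN, Complex.norm_real]
            exact le_abs_self _
        _ ≤ 1 := hτ1 _ hN
    choose σ hσ using fun k => exists_perm_abs_card_fixedPoints_sub_le
      (fun i hi => (hpos i hi).2) (hn k) (hc1 (n k))
    have hnω : Tendsto n (ω : Filter ℕ) atTop :=
      hn'.mono_left (hω.trans Nat.cofinite_eq_atTop.le)
    set p : ∀ k, Matrix (Fin (n k)) (Fin (n k)) ℂ := fun k =>
      Matrix.of fun i j => if i = σ k j then (1 : ℂ) else 0 with hp
    have hpu : ∀ k, p k ∈ Matrix.unitaryGroup (Fin (n k)) ℂ := fun k =>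
      permMatrix_mem_unitaryGroup (σ k)
    have hpτ : ∀ m : ℕ, 0 < m →
        Tendsto (fun k => nTr (p k ^ m) - τ m) (ω : Filter ℕ) (nhds 0) := by
      intro m hm
      refine squeeze_zero_norm' (a := fun k => (m + ∑ d ∈ m.divisors, (d : ℝ)) / n k) ?_
        (tendsto_const_nhds.div_atTop (tendsto_natCast_atTop_atTop.comp hnω))
      filter_upwards [hnω.eventually_ge_atTop m] with k hk
      refine le_trans (le_of_eq ?_) (hσ k m hm hk)
      rw [hp, nTr_permMatrix_pow, ← hcre m hm, ← Real.norm_eq_abs, ← Complex.norm_real]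
      push_cast
      rfl
    obtain ⟨w, hw, hlim⟩ := exists_unitary_conj_tendsto_trNorm_sub hn hu hpu
      (l := (ω : Filter ℕ)) fun m hm => by
        simpa using (tendsto_sub_nhds_zero_iff.mpr (hτ m hm)).sub (hpτ m hm)
    exact ⟨p, w, fun k => isPermMatrix_of_perm (σ k), hw, hlim⟩
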